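/- Fix an integer M ≥ 3 and a real α ∈ (0,1). For each m ≥ 1, let n_1,…,n_m be integers with 1 ≤ n_i ≤ M−1, set n = Σ_{i=1}^m n_i, and let ñ = (Σ_{i=1}^m r_i − (1−α)Mm/2)/α be the privacy-preserving estimate built from the independent randomized reports r_i = x_i n_i + (1−x_i) û_i with x_i ~ Bernoulli(α) and û_i uniform on {1,…,M−1}. Then the relative mean squared error satisfies E[(ñ/n − 1)²] ≤ (M−2)²/(4α² m); in particular, E[(ñ/n − 1)²] → 0 as the number m of sampled clients tends to infinity, so the privacy-preserving data-level sampling ratio p̃ = η/ñ converges in mean square to the centralized ratio p = η/n in the sense that their relative error vanishes. -/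

import Mathlib

open Finset

/-- The relative mean squared error `E[(ñ/n - 1)²]` of the privacy-preserving total-size
estimate `ñ = (∑ i, r i - (1 - α) M m / 2) / α` built from the `m` independent randomized
reports `r i = x i * n i + (1 - x i) * û i`, with `x i ~ Bernoulli(α)` (modeled by
`x : Fin m → Bool`, `P(x i = true) = α`) and `û i` uniform on `{1,…,M-1}`, all mutually
independent; here `n = ∑ i, n i` is the true total.  The expectation is an explicit sum
over the finite product sample space with weights
`∏ i, (if x i then α else 1 - α) * (M - 1)⁻¹`. -/
noncomputable def relMSE (M : ℕ) (α : ℝ) (m : ℕ) (n : Fin m → ℕ) : ℝ :=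
  ∑ x : Fin m → Bool, ∑ u ∈ Fintype.piFinset (fun _ : Fin m => Finset.Icc 1 (M - 1)),
    (∏ i, ((if x i then α else 1 - α) * ((M : ℝ) - 1)⁻¹)) *
      ((((∑ i, ((if x i then (1 : ℝ) else 0) * (n i : ℝ) +
              (1 - if x i then (1 : ℝ) else 0) * (u i : ℝ)))
            - (1 - α) * (M : ℝ) * (m : ℝ) / 2) / α) / (∑ i, (n i : ℝ)) - 1) ^ 2

section ProductSums

variable {ι β γ : Type*} [Fintype ι] [DecidableEq ι] [Fintype β]

/-- A double sum over two product spaces of a product of one-coordinate terms factorizes. -/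
theorem sum_sum_piFinset_prod (T : Finset γ) (g : ι → β → γ → ℝ) :
    ∑ x : ι → β, ∑ u ∈ Fintype.piFinset (fun _ : ι => T), ∏ i, g i (x i) (u i) =
      ∏ i, ∑ b, ∑ t ∈ T, g i b t := by
  rw [Finset.prod_univ_sum, Fintype.piFinset_univ]
  exact Finset.sum_congr rfl fun x _ => (Finset.prod_univ_sum _ _).symm

/-- Under a product weight of total mass one, two centred one-coordinate functions are
uncorrelated at distinct coordinates. -/
theorem sum_sum_piFinset_prod_mul_mul (T : Finset γ) (w : β → γ → ℝ)
    (hw : ∑ b, ∑ t ∈ T, w b t = 1) (f : ι → β → γ → ℝ)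
    (hf : ∀ i, ∑ b, ∑ t ∈ T, w b t * f i b t = 0) (j k : ι) :
    ∑ x : ι → β, ∑ u ∈ Fintype.piFinset (fun _ : ι => T),
        (∏ i, w (x i) (u i)) * (f j (x j) (u j) * f k (x k) (u k)) =
      if j = k then ∑ b, ∑ t ∈ T, w b t * f j b t ^ 2 else 0 := by
  have h := sum_sum_piFinset_prod T (fun i b t =>
    w b t * ((if i = j then f i b t else 1) * (if i = k then f i b t else 1)))
  simp only [Finset.prod_mul_distrib, Finset.prod_ite_eq', Finset.mem_univ, if_true] at h
  rw [h]
  split_ifs with hjk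
  · subst hjk
    rw [Finset.prod_eq_single_of_mem j (Finset.mem_univ j)]
    · simp [sq]
    · intro i _ hij
      simp [hij, hw]
  · apply Finset.prod_eq_zero (Finset.mem_univ j)
    simp [hjk, hf]

/-- The variance of a sum of independent centred terms is the sum of their variances. -/
theorem sum_sum_piFinset_prod_mul_sum_sq (T : Finset γ) (w : β → γ → ℝ)
    (hw : ∑ b, ∑ t ∈ T, w b t = 1) (f : ι → β → γ → ℝ)
    (hf : ∀ i, ∑ b, ∑ t ∈ T, w b t * f i b t = 0) :
    ∑ x : ι → β, ∑ u ∈ Fintype.piFinset (fun _ : ι => T),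
        (∏ i, w (x i) (u i)) * (∑ i, f i (x i) (u i)) ^ 2 =
      ∑ i, ∑ b, ∑ t ∈ T, w b t * f i b t ^ 2 := by
  simp only [sq (∑ i, f i _ _), Finset.sum_mul_sum]
  simp only [Finset.mul_sum]
  calc _ = ∑ j, ∑ k, ∑ x : ι → β, ∑ u ∈ Fintype.piFinset (fun _ : ι => T),
        (∏ i, w (x i) (u i)) * (f j (x j) (u j) * f k (x k) (u k)) := by
        simp only [Finset.sum_comm (s := Fintype.piFinset _) (t := Finset.univ)]
        rw [Finset.sum_comm]
        exact Finset.sum_congr rfl fun j _ => Finset.sum_comm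
    _ = _ := by
        simp [sum_sum_piFinset_prod_mul_mul T w hw f hf]

/-- **Popoviciu's inequality** for a finite weighted double sum: a function within distance `d`
of a point `c` has variance at most `d ^ 2`. -/
theorem sum_sum_mul_sub_sq_le (T : Finset γ) (w : β → γ → ℝ)
    (hw0 : ∀ b, ∀ t ∈ T, 0 ≤ w b t) (hw : ∑ b, ∑ t ∈ T, w b t = 1) (r : β → γ → ℝ) (μ c d : ℝ)
    (hμ : ∑ b, ∑ t ∈ T, w b t * (r b t - μ) = 0) (hr : ∀ b, ∀ t ∈ T, |r b t - c| ≤ d) :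
    ∑ b, ∑ t ∈ T, w b t * (r b t - μ) ^ 2 ≤ d ^ 2 := by
  have h1 : ∑ b, ∑ t ∈ T, w b t * (r b t - c) ^ 2 =
      ∑ b, ∑ t ∈ T, w b t * (r b t - μ) ^ 2 +
        2 * (μ - c) * ∑ b, ∑ t ∈ T, w b t * (r b t - μ) +
        (μ - c) ^ 2 * ∑ b, ∑ t ∈ T, w b t := by
    simp only [Finset.mul_sum, ← Finset.sum_add_distrib]
    exact Finset.sum_congr rfl fun b _ => Finset.sum_congr rfl fun t _ => by ring
  have h2 : ∑ b, ∑ t ∈ T, w b t * (r b t - c) ^ 2 ≤ d ^ 2 * ∑ b, ∑ t ∈ T, w b t := by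
    simp only [Finset.mul_sum]
    refine Finset.sum_le_sum fun b _ => Finset.sum_le_sum fun t ht => ?_
    rw [mul_comm (d ^ 2)]
    exact mul_le_mul_of_nonneg_left (sq_le_sq' (abs_le.1 (hr b t ht)).1 (abs_le.1 (hr b t ht)).2)
      (hw0 b t ht)
  rw [hμ, hw] at h1
  rw [hw] at h2
  nlinarith [sq_nonneg (μ - c)]

end ProductSums

theorem sum_Icc_one_natCast (N : ℕ) :
    ∑ t ∈ Finset.Icc 1 N, (t : ℝ) = (N : ℝ) * (N + 1) / 2 := by
  induction N with
  | zero => simp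
  | succ N ih =>
    rw [Finset.sum_Icc_succ_top (by omega), ih]
    push_cast
    ring

theorem relMSE_le (M : ℕ) (hM : 3 ≤ M) (α : ℝ) (hα : α ∈ Set.Ioo (0 : ℝ) 1)
    (m : ℕ) (hm : 1 ≤ m) (n : Fin m → ℕ) (hn : ∀ i, 1 ≤ n i ∧ n i ≤ M - 1) :
    relMSE M α m n ≤ ((M : ℝ) - 2) ^ 2 / (4 * α ^ 2 * (m : ℝ)) := by
  obtain ⟨hα0, hα1⟩ := hα
  obtain ⟨N, rfl⟩ : ∃ N, M = N + 1 := ⟨M - 1, by omega⟩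
  simp only [Nat.add_sub_cancel] at hn
  have hN : (2 : ℝ) ≤ N := by exact_mod_cast (by omega : 2 ≤ N)
  have hm' : (1 : ℝ) ≤ m := by exact_mod_cast hm
  set S : ℝ := ∑ i, (n i : ℝ) with hS
  have hmS : (m : ℝ) ≤ S := by
    have : ∑ _i : Fin m, (1 : ℝ) ≤ S :=
      Finset.sum_le_sum fun i _ => by exact_mod_cast (hn i).1
    simpa using this
  have hS0 : 0 < S := by linarith
  let w : Bool → ℕ → ℝ := fun b _ => (if b then α else 1 - α) * (((N + 1 : ℕ) : ℝ) - 1)⁻¹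
  let r : Fin m → Bool → ℕ → ℝ := fun i b t =>
    (if b then (1 : ℝ) else 0) * (n i : ℝ) + (1 - if b then (1 : ℝ) else 0) * (t : ℝ)
  let μ : Fin m → ℝ := fun i => α * n i + (1 - α) * (N + 1) / 2
  have hw0 : ∀ b, ∀ t ∈ Finset.Icc 1 N, 0 ≤ w b t := by
    intro b t _
    have : (0 : ℝ) ≤ (((N + 1 : ℕ) : ℝ) - 1)⁻¹ := by simp
    cases b
    · simpa [w] using mul_nonneg (by linarith : 0 ≤ 1 - α) this
    · simpa [w] using mul_nonneg hα0.le this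
  have hw : ∑ b, ∑ t ∈ Finset.Icc 1 N, w b t = 1 := by
    simp [w]
    field_simp
    ring
  have hμ : ∀ i, ∑ b, ∑ t ∈ Finset.Icc 1 N, w b t * (r i b t - μ i) = 0 := by
    intro i
    simp [w, r, μ, ← Finset.mul_sum, Finset.sum_sub_distrib, sum_Icc_one_natCast]
    field_simp
    ring
  have hr : ∀ i b, ∀ t ∈ Finset.Icc 1 N, |r i b t - ((N : ℝ) + 1) / 2| ≤ ((N : ℝ) - 1) / 2 := by
    intro i b t ht
    rw [Finset.mem_Icc] at ht
    have h1 : (1 : ℝ) ≤ t := by exact_mod_cast ht.1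
    have h2 : (t : ℝ) ≤ N := by exact_mod_cast ht.2
    have h3 : (1 : ℝ) ≤ n i := by exact_mod_cast (hn i).1
    have h4 : (n i : ℝ) ≤ N := by exact_mod_cast (hn i).2
    rw [abs_le]
    cases b <;> simp [r] <;> constructor <;> linarith
  have hvar := sum_sum_piFinset_prod_mul_sum_sq (Finset.Icc 1 N) w hw
    (fun i b t => r i b t - μ i) hμ
  have hbound : ∑ i, ∑ b, ∑ t ∈ Finset.Icc 1 N, w b t * (r i b t - μ i) ^ 2 ≤
      m * (((N : ℝ) - 1) / 2) ^ 2 := by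
    refine (Finset.sum_le_sum fun i _ =>
      sum_sum_mul_sub_sq_le _ w hw0 hw (r i) (μ i) _ _ (hμ i) (hr i)).trans ?_
    simp
  have hrel : relMSE (N + 1) α m n =
      (∑ i, ∑ b, ∑ t ∈ Finset.Icc 1 N, w b t * (r i b t - μ i) ^ 2) / (α * S) ^ 2 := by
    rw [← hvar, relMSE, Finset.sum_div]
    refine Finset.sum_congr rfl fun x _ => ?_
    rw [Finset.sum_div]
    refine Finset.sum_congr rfl fun u _ => ?_
    rw [mul_div_assoc (∏ i, w (x i) (u i)), ← div_pow]
    congr 2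
    have hμS : ∑ i, μ i = α * S + (1 - α) * (N + 1) / 2 * m := by
      simp only [μ, Finset.sum_add_distrib, ← Finset.mul_sum, hS]
      simp
      ring
    rw [Finset.sum_sub_distrib, hμS, ← hS]
    simp only [r]
    push_cast
    field_simp
    ring
  rw [hrel]
  calc _ ≤ m * (((N : ℝ) - 1) / 2) ^ 2 / (α * m) ^ 2 := by gcongr
    _ = _ := by
      push_cast
      field_simp
      ring

theorem relMSE_nonneg (M : ℕ) (hM : 1 ≤ M) (α : ℝ) (hα : α ∈ Set.Icc (0 : ℝ) 1)
    (m : ℕ) (n : Fin m → ℕ) : 0 ≤ relMSE M α m n := by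
  have hM' : (0 : ℝ) ≤ (M : ℝ) - 1 := sub_nonneg.2 (by exact_mod_cast hM)
  refine Finset.sum_nonneg fun x _ => Finset.sum_nonneg fun u _ =>
    mul_nonneg (Finset.prod_nonneg fun i _ => mul_nonneg ?_ (inv_nonneg.2 hM')) (sq_nonneg _)
  split_ifs
  · exact hα.1
  · exact sub_nonneg.2 hα.2

/-- **The privacy-preserving sampling ratio converges to the centralized one.**
For every number `m ≥ 1` of sampled clients and clipped data sizes `n i ∈ {1,…,M-1}`,
the relative mean squared error between `ñ` and `n` satisfies
`E[(ñ/n - 1)²] ≤ (M - 2)² / (4 α² m)`; in particular, for any choice of client data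
sizes for each `m`, `E[(ñ/n - 1)²] → 0` as `m → ∞`, so the privacy-preserving
data-level sampling ratio `p̃ = η/ñ` matches the centralized ratio `p = η/n` in the
limit of vanishing relative error. -/
theorem relMSE_le_and_tendsto_zero
    (M : ℕ) (hM : 3 ≤ M) (α : ℝ) (hα : α ∈ Set.Ioo (0 : ℝ) 1) :
    (∀ m : ℕ, 1 ≤ m → ∀ n : Fin m → ℕ, (∀ i, 1 ≤ n i ∧ n i ≤ M - 1) →
      relMSE M α m n ≤ ((M : ℝ) - 2) ^ 2 / (4 * α ^ 2 * (m : ℝ))) ∧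
    (∀ n : (m : ℕ) → Fin m → ℕ, (∀ m i, 1 ≤ n m i ∧ n m i ≤ M - 1) →
      Filter.Tendsto (fun m : ℕ => relMSE M α m (n m)) Filter.atTop (nhds 0)) := by
  refine ⟨relMSE_le M hM α hα, fun n hn => ?_⟩
  have hlim : Filter.Tendsto (fun m : ℕ => ((M : ℝ) - 2) ^ 2 / (4 * α ^ 2 * (m : ℝ)))
      Filter.atTop (nhds 0) := by
    have hα2 : 0 < 4 * α ^ 2 := mul_pos four_pos (pow_pos hα.1 2)
    exact (tendsto_natCast_atTop_atTop.const_mul_atTop hα2).const_div_atTop _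
  refine squeeze_zero' (Filter.Eventually.of_forall fun m =>
    relMSE_nonneg M (by omega) α (Set.Ioo_subset_Icc_self hα) m (n m)) ?_ hlim
  filter_upwards [Filter.eventually_ge_atTop 1] with m hm
  exact relMSE_le M hM α hα m hm (n m) (hn m)
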